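/- For all C,B,A∈K_+, the element H = i^C j^B i^A of 𝒰(K_+) admits a descent chain along the reduced word (i,j,i) ending at i^0 j^0 i^0, whose tuple is (c_1,c_2,c_3) = (C, B+A, B); explicitly one may take H_1 = i^C j^B i^A, H_2 = i^0 j^B i^A = j^{B+A} i^0 j^B, H_3 = j^0 i^0 j^B = i^B j^0 i^0, and H_4 = i^0 j^0 i^0. Consequently, a triple (γ,β,α)∈K_+^3 is the tuple of such a descent chain (ending at i^0 j^0 i^0) of some element of 𝒰(K_+) along (i,j,i) if and only if β ≥ α. -/

import Mathlib

open FreeMonoid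

/-- The minimum of two elements of an additive subgroup of `ℝ`
(the "sum" in the tropical semifield `K`). -/
noncomputable def kmin {K : AddSubgroup ℝ} (a b : K) : K :=
  if (a : ℝ) ≤ (b : ℝ) then a else b

/-- Defining relations of the monoid `𝔘(K)` attached to a simply laced Coxeter matrix `M`
and the tropical semifield `K` (a subgroup of `(ℝ, +)` with sum `min` and product `+`). -/
inductive UKRel {I : Type*} (M : CoxeterMatrix I) (K : AddSubgroup ℝ) :
    FreeMonoid (I × K) → FreeMonoid (I × K) → Prop
  | comm (i j : I) (h : M i j = 2) (a b : K) :
      UKRel M K (of (i, a) * of (j, b)) (of (j, b) * of (i, a))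
  | braid (i j : I) (h : M i j = 3) (a b c : K) :
      UKRel M K (of (i, a) * of (j, b) * of (i, c))
        (of (j, b + c - kmin a c) * of (i, kmin a c) * of (j, a + b - kmin a c))
  | idem (i : I) (a b : K) :
      UKRel M K (of (i, a) * of (i, b)) (of (i, kmin a b))

/-- The monoid `𝔘(K)`. -/
noncomputable def UK {I : Type*} (M : CoxeterMatrix I) (K : AddSubgroup ℝ) :=
  (conGen (UKRel M K)).Quotient

noncomputable instance {I : Type*} (M : CoxeterMatrix I) (K : AddSubgroup ℝ) :
    Monoid (UK M K) := Con.monoid _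

/-- The generator `i^a` of `𝔘(K)`. -/
noncomputable def genU {I : Type*} (M : CoxeterMatrix I) (K : AddSubgroup ℝ)
    (i : I) (a : K) : UK M K :=
  (Con.mk' _) (of (i, a))

/-- The product `i₁^{a₁} ⋯ i_n^{a_n}` in `𝔘(K)` associated to a list of pairs. -/
noncomputable def prodU {I : Type*} (M : CoxeterMatrix I) (K : AddSubgroup ℝ)
    (ω : List (I × K)) : UK M K :=
  (ω.map fun p => genU M K p.1 p.2).prod

/-- `l` is a reduced word of `w`. -/
def IsRedWord {I W : Type*} [Group W] {M : CoxeterMatrix I} (cs : CoxeterSystem M W)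
    (w : W) (l : List I) : Prop :=
  cs.wordProd l = w ∧ l.length = cs.length w

/-- The set `𝒰(K) = 𝔘_{w₀}(K)` of products over reduced words of `w₀`. -/
noncomputable def calU {I W : Type*} [Group W] (M : CoxeterMatrix I) (K : AddSubgroup ℝ)
    (cs : CoxeterSystem M W) (w₀ : W) : Set (UK M K) :=
  {u | ∃ ω : List (I × K), IsRedWord cs w₀ (ω.map Prod.fst) ∧ u = prodU M K ω}

/-- The set `𝒰(K₊)`: products over reduced words of `w₀` with coefficients in `K₊ = K ∩ ℝ≥0`. -/
noncomputable def calUplus {I W : Type*} [Group W] (M : CoxeterMatrix I) (K : AddSubgroup ℝ)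
    (cs : CoxeterSystem M W) (w₀ : W) : Set (UK M K) :=
  {u | ∃ ω : List (I × K), IsRedWord cs w₀ (ω.map Prod.fst) ∧
        (∀ p ∈ ω, 0 ≤ (p.2 : ℝ)) ∧ u = prodU M K ω}

/-- Two vertices of the graph on `𝒰(K)` are joined by an edge. -/
noncomputable def UEdge {I W : Type*} [Group W] (M : CoxeterMatrix I) (K : AddSubgroup ℝ)
    (cs : CoxeterSystem M W) (w₀ : W) (H H' : UK M K) : Prop :=
  H ≠ H' ∧ ∃ (i : I) (b b' : K) (ω : List (I × K)),
    IsRedWord cs w₀ (i :: ω.map Prod.fst) ∧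
    H = genU M K i b * prodU M K ω ∧ H' = genU M K i b' * prodU M K ω

/-- `H` and `H'` are at distance `≤ k` in the graph on `𝒰(K)`. -/
noncomputable def DistLE {I W : Type*} [Group W] (M : CoxeterMatrix I) (K : AddSubgroup ℝ)
    (cs : CoxeterSystem M W) (w₀ : W) (k : ℕ) (H H' : UK M K) : Prop :=
  ∃ f : ℕ → UK M K, f 0 = H ∧ f k = H' ∧ (∀ t ≤ k, f t ∈ calU M K cs w₀) ∧
    ∀ t < k, f t = f (t + 1) ∨ UEdge M K cs w₀ (f t) (f (t + 1))

/-- A descent chain for `H ∈ 𝒰(K₊)` along a reduced word `l` of `w₀`: a sequence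
`H = Hs 0, Hs 1, …, Hs l.length` in `𝒰(K₊)` together with a tuple `c` in `K₊` such that
at each step `k`, for some reduced word of `w₀` beginning with `l.get k` and some
coefficients in `K₊`, `Hs k = (l.get k)^{c k} · j₂^{a₂} ⋯ j_ν^{a_ν}` and
`Hs (k+1) = (l.get k)^{0} · j₂^{a₂} ⋯ j_ν^{a_ν}`. -/
noncomputable def DescentChain {I W : Type*} [Group W] (M : CoxeterMatrix I)
    (K : AddSubgroup ℝ) (cs : CoxeterSystem M W) (w₀ : W)
    (l : List I) (H : UK M K) (Hs : ℕ → UK M K) (c : ℕ → K) : Prop :=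
  Hs 0 = H ∧
  (∀ k ≤ l.length, Hs k ∈ calUplus M K cs w₀) ∧
  (∀ k < l.length, 0 ≤ (c k : ℝ)) ∧
  ∀ (k : ℕ) (hk : k < l.length), ∃ ω : List (I × K),
    (∀ p ∈ ω, 0 ≤ (p.2 : ℝ)) ∧
    IsRedWord cs w₀ (l.get ⟨k, hk⟩ :: ω.map Prod.fst) ∧
    Hs k = genU M K (l.get ⟨k, hk⟩) (c k) * prodU M K ω ∧
    Hs (k + 1) = genU M K (l.get ⟨k, hk⟩) 0 * prodU M K ω

/-- The tropical elementary matrix `1 + a E_{i,i+1}` acting on column vectors of length three. -/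
noncomputable def tropicalShear (i : Fin 2) (a : ℝ) : Function.End (ℝ × ℝ × ℝ) :=
  fun x => if i = 0 then (min x.1 (a + x.2.1), x.2.1, x.2.2)
    else (x.1, min x.2.1 (a + x.2.2), x.2.2)

theorem tropicalShear_zero_apply (a : ℝ) (x : ℝ × ℝ × ℝ) :
    tropicalShear 0 a x = (min x.1 (a + x.2.1), x.2.1, x.2.2) := rfl

theorem tropicalShear_one_apply (a : ℝ) (x : ℝ × ℝ × ℝ) :
    tropicalShear 1 a x = (x.1, min x.2.1 (a + x.2.2), x.2.2) := rfl

theorem coe_kmin {K : AddSubgroup ℝ} (a b : K) : ((kmin a b : K) : ℝ) = min (a : ℝ) b := by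
  unfold kmin
  split_ifs with h
  · exact (min_eq_left h).symm
  · exact (min_eq_right (not_le.1 h).le).symm

theorem tropicalShear_idem (i : Fin 2) (a b : ℝ) :
    tropicalShear i a * tropicalShear i b = tropicalShear i (min a b) := by
  funext x
  obtain ⟨u, v, w⟩ := x
  change tropicalShear i a (tropicalShear i b (u, v, w)) = _
  fin_cases i <;>
    simp [tropicalShear, ← min_add_add_right, min_assoc, min_comm (a + _) (b + _)]

theorem tropicalShear_braid {i j : Fin 2} (h : i ≠ j) (a b c : ℝ) :
    tropicalShear i a * tropicalShear j b * tropicalShear i c =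
      tropicalShear j (b + c - min a c) * tropicalShear i (min a c) *
        tropicalShear j (a + b - min a c) := by
  funext x
  obtain ⟨u, v, w⟩ := x
  change tropicalShear i a (tropicalShear j b (tropicalShear i c (u, v, w))) =
    tropicalShear j _ (tropicalShear i _ (tropicalShear j _ (u, v, w)))
  fin_cases i <;> fin_cases j <;>
    simp [tropicalShear_zero_apply, tropicalShear_one_apply] at h ⊢ <;>
    grind

/-- The action of `𝔘(K)`, in type `A₂`, by tropical unipotent matrices. -/
noncomputable def tropicalAction {M : CoxeterMatrix (Fin 2)}
    (hM : ∀ i j : Fin 2, i ≠ j → M i j = 3) (K : AddSubgroup ℝ) :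
    UK M K →* Function.End (ℝ × ℝ × ℝ) :=
  Con.lift (conGen (UKRel M K)) (FreeMonoid.lift fun p => tropicalShear p.1 (p.2 : ℝ)) <| by
    rw [Con.conGen_le]
    intro x y hxy
    have ne_of_eq {i j : Fin 2} (h : M i j ≠ 1) : i ≠ j := by
      rintro rfl
      exact h (M.diagonal i)
    rw [Con.ker_rel]
    cases hxy with
    | comm i j h a b =>
      have := hM i j (ne_of_eq (by omega))
      omega
    | braid i j h a b c =>
      simpa [coe_kmin] using tropicalShear_braid (ne_of_eq (by omega)) (a : ℝ) b c
    | idem i a b => simpa [coe_kmin] using tropicalShear_idem i (a : ℝ) b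

theorem tropicalAction_genU {M : CoxeterMatrix (Fin 2)}
    (hM : ∀ i j : Fin 2, i ≠ j → M i j = 3) {K : AddSubgroup ℝ} (i : Fin 2) (a : K) :
    tropicalAction hM K (genU M K i a) = tropicalShear i (a : ℝ) := by
  change FreeMonoid.lift (fun p : Fin 2 × K => tropicalShear p.1 (p.2 : ℝ)) (of (i, a)) = _
  simp

theorem tropicalAction_genU_triple {M : CoxeterMatrix (Fin 2)}
    (hM : ∀ i j : Fin 2, i ≠ j → M i j = 3) {K : AddSubgroup ℝ} (i j k : Fin 2) (a b c : K)
    (x : ℝ × ℝ × ℝ) :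
    tropicalAction hM K (genU M K i a * genU M K j b * genU M K k c) x =
      tropicalShear i (a : ℝ) (tropicalShear j (b : ℝ) (tropicalShear k (c : ℝ) x)) := by
  simp only [map_mul, tropicalAction_genU]
  rfl

/-- The middle exponent of `i^a j^b i^c` is determined by this element. -/
theorem middle_exponent_eq {M : CoxeterMatrix (Fin 2)}
    (hM : ∀ i j : Fin 2, i ≠ j → M i j = 3) {K : AddSubgroup ℝ} {a b c a' b' c' : K}
    (h : genU M K 0 a * genU M K 1 b * genU M K 0 c =
      genU M K 0 a' * genU M K 1 b' * genU M K 0 c') :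
    (b : ℝ) = b' := by
  have hx (v : ℝ) := congrArg (fun g => (tropicalAction hM K g (0, v, 0)).2.1) h
  simp only [tropicalAction_genU_triple, tropicalShear_zero_apply, tropicalShear_one_apply,
    add_zero] at hx
  have := hx (max (b : ℝ) b')
  simpa using this

/-- The matrix entries of `i^a j^b i^c` and `j^a' i^b' j^c'` agree when these are equal. -/
theorem entries_eq_of_opposite_word {M : CoxeterMatrix (Fin 2)}
    (hM : ∀ i j : Fin 2, i ≠ j → M i j = 3) {K : AddSubgroup ℝ} {a b c a' b' c' : K}
    (h : genU M K 0 a * genU M K 1 b * genU M K 0 c =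
      genU M K 1 a' * genU M K 0 b' * genU M K 1 c') :
    min (a : ℝ) c = b' ∧ (b : ℝ) = min (a' : ℝ) c' ∧ (a + b : ℝ) = b' + c' := by
  have hx (x : ℝ × ℝ × ℝ) := congrArg (fun g => tropicalAction hM K g x) h
  simp only [tropicalAction_genU_triple, tropicalShear_zero_apply, tropicalShear_one_apply,
    Prod.mk.injEq] at hx
  generalize (a : ℝ) = a, (b : ℝ) = b, (c : ℝ) = c, (a' : ℝ) = a', (b' : ℝ) = b',
    (c' : ℝ) = c' at hx ⊢
  clear h
  obtain ⟨N, hN⟩ : ∃ N, N = |a| + |b| + |c| + |a'| + |b'| + |c'| := ⟨_, rfl⟩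
  have ha := abs_le.1 (le_refl |a|)
  have hb := abs_le.1 (le_refl |b|)
  have hc := abs_le.1 (le_refl |c|)
  have ha' := abs_le.1 (le_refl |a'|)
  have hb' := abs_le.1 (le_refl |b'|)
  have hc' := abs_le.1 (le_refl |c'|)
  generalize |a| = A, |b| = B, |c| = C, |a'| = A', |b'| = B', |c'| = C' at *
  refine ⟨?_, ?_, ?_⟩
  · have := (hx (N, 0, N)).1
    clear hx
    dsimp only at this
    rw [min_eq_left (by linarith : 0 ≤ b + N), min_eq_left (by linarith : 0 ≤ c' + N)] at this
    grind
  · have := (hx (0, N, 0)).2.1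
    clear hx
    grind
  · have := (hx (N, 2 * N, 0)).1
    clear hx
    dsimp only at this
    rw [min_eq_right (by linarith : b + 0 ≤ 2 * N), min_eq_right (by linarith : c' + 0 ≤ 2 * N),
      min_eq_left (by linarith : N ≤ c + 2 * N), min_eq_right (by linarith : a + (b + 0) ≤ N),
      min_eq_right (by linarith : b' + (c' + 0) ≤ N)] at this
    simpa using this

theorem IsRedWord.eq_alternating {W : Type*} [Group W] {M : CoxeterMatrix (Fin 2)}
    {cs : CoxeterSystem M W} {w : W} (hw : cs.length w = 3) {X : Type*} {i : Fin 2}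
    {ω : List (Fin 2 × X)} (h : IsRedWord cs w (i :: ω.map Prod.fst)) :
    ∃ j a b, j ≠ i ∧ ω = [(j, a), (i, b)] := by
  obtain ⟨hp, hl⟩ := h
  obtain ⟨⟨j, a⟩, ⟨k, b⟩, rfl⟩ := List.length_eq_two.1 (show ω.length = 2 by simpa [hw] using hl)
  have hji : j ≠ i := by
    rintro rfl
    have : w = cs.simple k := by simpa [CoxeterSystem.wordProd_cons] using hp.symm
    rw [this, cs.length_simple] at hw
    omega
  have hkj : k ≠ j := by
    rintro rfl
    have : w = cs.simple i := by simpa [CoxeterSystem.wordProd_cons] using hp.symm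
    rw [this, cs.length_simple] at hw
    omega
  obtain rfl : k = i := by omega
  exact ⟨j, a, b, hji, rfl⟩

theorem IsRedWord.braid {I W : Type*} [Group W] {M : CoxeterMatrix I}
    {cs : CoxeterSystem M W} {w : W} {i j : I} (hij : M i j = 3)
    (h : IsRedWord cs w [i, j, i]) : IsRedWord cs w [j, i, j] := by
  obtain ⟨hp, hl⟩ := h
  refine ⟨hp ▸ ?_, hl⟩
  have := cs.wordProd_braidWord_eq i j
  rw [CoxeterSystem.braidWord, CoxeterSystem.braidWord, M.symmetric j i, hij] at this
  simpa [CoxeterSystem.alternatingWord] using this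

theorem genU_triple_mem_calUplus {I W : Type*} [Group W] {M : CoxeterMatrix I}
    {K : AddSubgroup ℝ} {cs : CoxeterSystem M W} {w : W} {i j k : I}
    (h : IsRedWord cs w [i, j, k]) {a b c : K}
    (ha : 0 ≤ (a : ℝ)) (hb : 0 ≤ (b : ℝ)) (hc : 0 ≤ (c : ℝ)) :
    genU M K i a * genU M K j b * genU M K k c ∈ calUplus M K cs w :=
  ⟨[(i, a), (j, b), (k, c)], h, by simp [ha, hb, hc], by simp [prodU, mul_assoc]⟩

theorem genU_braid {I : Type*} {M : CoxeterMatrix I} {K : AddSubgroup ℝ} {i j : I}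
    (h : M i j = 3) (a b c : K) :
    genU M K i a * genU M K j b * genU M K i c =
      genU M K j (b + c - kmin a c) * genU M K i (kmin a c) * genU M K j (a + b - kmin a c) :=
  (Con.eq _).2 (ConGen.Rel.of _ _ (UKRel.braid i j h a b c))

theorem genU_braid_zero_left {I : Type*} {M : CoxeterMatrix I} {K : AddSubgroup ℝ} {i j : I}
    (h : M i j = 3) (b : K) {c : K} (hc : 0 ≤ (c : ℝ)) :
    genU M K i 0 * genU M K j b * genU M K i c =
      genU M K j (b + c) * genU M K i 0 * genU M K j b := by
  have hmin : kmin 0 c = 0 := if_pos (by simpa using hc)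
  simpa [hmin] using genU_braid h 0 b c

/-- The explicit descent chain starting at `i^C j^B i^A`. -/
noncomputable def explicitChain (M : CoxeterMatrix (Fin 2)) (K : AddSubgroup ℝ) (C B A : K) :
    ℕ → UK M K
  | 0 => genU M K 0 C * genU M K 1 B * genU M K 0 A
  | 1 => genU M K 0 0 * genU M K 1 B * genU M K 0 A
  | 2 => genU M K 1 0 * genU M K 0 0 * genU M K 1 B
  | _ => genU M K 0 0 * genU M K 1 0 * genU M K 0 0

theorem explicitChain_descentChain {W : Type*} [Group W] {M : CoxeterMatrix (Fin 2)}
    (hM : ∀ i j : Fin 2, i ≠ j → M i j = 3) {cs : CoxeterSystem M W} {K : AddSubgroup ℝ} {w₀ : W}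
    (hl : IsRedWord cs w₀ [0, 1, 0]) {C B A : K}
    (hC : 0 ≤ (C : ℝ)) (hB : 0 ≤ (B : ℝ)) (hA : 0 ≤ (A : ℝ)) :
    DescentChain M K cs w₀ [0, 1, 0] (genU M K 0 C * genU M K 1 B * genU M K 0 A)
      (explicitChain M K C B A) (fun t => if t = 0 then C else if t = 1 then B + A else B) := by
  have hl' := hl.braid (hM 0 1 (by decide))
  have h0 : (0 : ℝ) ≤ ((0 : K) : ℝ) := le_rfl
  refine ⟨rfl, fun k hk => ?_, fun k hk => ?_, fun k hk => ?_⟩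
  · have hk : k ≤ 3 := hk
    interval_cases k
    · exact genU_triple_mem_calUplus hl hC hB hA
    · exact genU_triple_mem_calUplus hl h0 hB hA
    · exact genU_triple_mem_calUplus hl' h0 h0 hB
    · exact genU_triple_mem_calUplus hl h0 h0 h0
  · dsimp only
    split_ifs
    · exact hC
    · exact add_nonneg hB hA
    · exact hB
  · have hk' : k < 3 := hk
    interval_cases k
    · exact ⟨[(1, B), (0, A)], by simp [hB, hA], hl, by simp [explicitChain, prodU, mul_assoc],
        by simp [explicitChain, prodU, mul_assoc]⟩
    · refine ⟨[(0, 0), (1, B)], by simp [hB], hl', ?_, by simp [explicitChain, prodU, mul_assoc]⟩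
      simpa [explicitChain, prodU, mul_assoc] using
        genU_braid_zero_left (hM 0 1 (by decide)) B hA
    · refine ⟨[(1, 0), (0, 0)], by simp, hl, ?_, by simp [explicitChain, prodU, mul_assoc]⟩
      simpa [explicitChain, prodU, mul_assoc] using
        genU_braid_zero_left (hM 1 0 (by decide)) 0 hB

theorem DescentChain.le_of_end_eq {W : Type*} [Group W] {M : CoxeterMatrix (Fin 2)}
    (hM : ∀ i j : Fin 2, i ≠ j → M i j = 3) {cs : CoxeterSystem M W} {K : AddSubgroup ℝ} {w₀ : W}
    (hw₀ : cs.length w₀ = 3) {H : UK M K} {Hs : ℕ → UK M K} {c : ℕ → K}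
    (h : DescentChain M K cs w₀ [0, 1, 0] H Hs c)
    (hend : Hs 3 = genU M K 0 0 * genU M K 1 0 * genU M K 0 0) :
    (c 2 : ℝ) ≤ c 1 := by
  obtain ⟨-, -, -, hstep⟩ := h
  have step (k : ℕ) (i : Fin 2) (hk : k < 3) (hi : [0, 1, 0].get ⟨k, hk⟩ = i) :
      ∃ (j : Fin 2) (a b : K), j ≠ i ∧ 0 ≤ (a : ℝ) ∧ 0 ≤ (b : ℝ) ∧
        Hs k = genU M K i (c k) * genU M K j a * genU M K i b ∧
        Hs (k + 1) = genU M K i 0 * genU M K j a * genU M K i b := by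
    obtain ⟨ω, hpos, hred, h₁, h₂⟩ := hstep k hk
    rw [hi] at hred h₁ h₂
    obtain ⟨j, a, b, hj, rfl⟩ := hred.eq_alternating hw₀
    exact ⟨j, a, b, hj, hpos (j, a) (by simp), hpos (i, b) (by simp),
      by simpa [prodU, mul_assoc] using h₁, by simpa [prodU, mul_assoc] using h₂⟩
  obtain ⟨j₁, a₁, b₁, hj₁, -, hb₁, -, h₁⟩ := step 0 0 (by simp) rfl
  obtain ⟨j₂, a₂, b₂, hj₂, -, -, h₂, h₂'⟩ := step 1 1 (by simp) rfl
  obtain ⟨j₃, a₃, b₃, hj₃, -, -, h₃, h₃'⟩ := step 2 0 (by simp) rfl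
  obtain rfl : j₁ = 1 := by omega
  obtain rfl : j₂ = 0 := by omega
  obtain rfl : j₃ = 1 := by omega
  have e₃ : (a₃ : ℝ) = (0 : K) := middle_exponent_eq hM (h₃'.symm.trans hend)
  obtain ⟨-, -, e₂⟩ := entries_eq_of_opposite_word hM (h₃.symm.trans h₂')
  obtain ⟨p₁, q₁, r₁⟩ := entries_eq_of_opposite_word hM (h₁.symm.trans h₂)
  simp only [ZeroMemClass.coe_zero] at e₃ p₁ r₁
  rw [min_eq_left hb₁] at p₁
  have := min_le_left (c 1 : ℝ) b₂
  linarith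

/-- **No. 15** (Lusztig, "Half circles on flag manifolds over a semifield").
Rank 2 case: `I = {i, j}` with `i·j = -1` (i.e. `m(i,j) = 3`, so `W ≅ S₃`, `ν = 3`,
`w₀ = s_i s_j s_i`), here with `i = 0`, `j = 1` in `Fin 2`.  For `C, B, A ∈ K₊`, the
element `H = i^C j^B i^A` admits a descent chain along `(i, j, i)` ending at
`i^0 j^0 i^0` with tuple `(γ, β, α) = (C, B + A, B)`; explicitly one may take
`H₁ = i^C j^B i^A`, `H₂ = i^0 j^B i^A = j^{B+A} i^0 j^B`,
`H₃ = j^0 i^0 j^B = i^B j^0 i^0`, `H₄ = i^0 j^0 i^0`.  Consequently,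
`(γ, β, α) ∈ K₊³` is the tuple of such a descent chain of some element of `𝒰(K₊)`
along `(i, j, i)` if and only if `β ≥ α`. -/
theorem rank_two_example
    {W : Type*} [Group W] [Finite W]
    (M : CoxeterMatrix (Fin 2)) (hM : ∀ i j : Fin 2, i ≠ j → M i j = 3)
    (cs : CoxeterSystem M W)
    (K : AddSubgroup ℝ) (hK : K ≠ ⊥)
    (w₀ : W) (hw₀ : cs.length w₀ = 3) (hν : ∀ w : W, cs.length w ≤ 3)
    (hl : IsRedWord cs w₀ [0, 1, 0]) :
    (∀ C B A : K, 0 ≤ (C : ℝ) → 0 ≤ (B : ℝ) → 0 ≤ (A : ℝ) →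
      ∃ Hs : ℕ → UK M K,
        DescentChain M K cs w₀ [0, 1, 0] (genU M K 0 C * genU M K 1 B * genU M K 0 A) Hs
          (fun t => if t = 0 then C else if t = 1 then B + A else B) ∧
        Hs 1 = genU M K 0 0 * genU M K 1 B * genU M K 0 A ∧
        genU M K 0 0 * genU M K 1 B * genU M K 0 A
          = genU M K 1 (B + A) * genU M K 0 0 * genU M K 1 B ∧
        Hs 2 = genU M K 1 0 * genU M K 0 0 * genU M K 1 B ∧
        genU M K 1 0 * genU M K 0 0 * genU M K 1 B
          = genU M K 0 B * genU M K 1 0 * genU M K 0 0 ∧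
        Hs 3 = genU M K 0 0 * genU M K 1 0 * genU M K 0 0) ∧
    (∀ γ β α : K, 0 ≤ (γ : ℝ) → 0 ≤ (β : ℝ) → 0 ≤ (α : ℝ) →
      ((∃ H ∈ calUplus M K cs w₀, ∃ Hs : ℕ → UK M K,
          DescentChain M K cs w₀ [0, 1, 0] H Hs
            (fun t => if t = 0 then γ else if t = 1 then β else α) ∧
          Hs 3 = genU M K 0 0 * genU M K 1 0 * genU M K 0 0) ↔
        (α : ℝ) ≤ (β : ℝ))) := by
  refine ⟨fun C B A hC hB hA => ⟨explicitChain M K C B A,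
    explicitChain_descentChain hM hl hC hB hA, rfl, genU_braid_zero_left (hM 0 1 (by decide)) B hA,
    rfl, ?_, rfl⟩, fun γ β α hγ _ hα => ⟨?_, fun h => ?_⟩⟩
  · simpa using genU_braid_zero_left (hM 1 0 (by decide)) 0 hB
  · rintro ⟨H, -, Hs, hH, hend⟩
    simpa using hH.le_of_end_eq hM hw₀ hend
  · have hchain := explicitChain_descentChain (A := β - α) hM hl hγ hα (by simpa using h)
    rw [add_sub_cancel] at hchain
    exact ⟨_, hchain.2.1 0 (Nat.zero_le _), _, hchain, rfl⟩
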